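/- arXiv:2402.12152 — 7 statements merged into one kernel-verified Lean document; each statement's English description precedes it below -/
import Mathlib

section
/- Suppose the triple (y, δy, δy⁺) satisfies the one-step accelerated-flow relation with time step τ > 0 and damping parameter η ∈ ℝ. Then the following identity holds: 0 = (1/(2τ²))·(‖δy⁺‖² − ‖δy‖²) + E(y⁺) − E(y) + ((1−η)/(2τ²))·(‖δy‖² + ‖δy⁺‖²) + ((1+η)/2)·B(δy⁺, δy⁺) + (η/2)·B(δy, δy) + (η/(2τ²))·‖δy⁺ − δy‖² − (η/2)·B(δy⁺ − δy, δy⁺ − δy). -/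
open RealInnerProductSpace

/-- Energy identity for one step of the accelerated gradient flow (abstract form). -/
theorem accelerated_flow_energy_identity
    {H : Type*} [NormedAddCommGroup H] [InnerProductSpace ℝ H]
    (B : H →ₗ[ℝ] H →ₗ[ℝ] ℝ)
    (hBsymm : ∀ u v : H, B u v = B v u)
    (E : H → ℝ) (hE : ∀ z : H, E z = (1 / 2) * B z z)
    (τ : ℝ) (hτ : 0 < τ) (η : ℝ)
    (y δy δyp : H)
    (hrel : ∀ v : H,
      (1 / τ ^ 2) * ⟪δyp - δy, v⟫ + ((1 - η) / τ ^ 2) * ⟪δy, v⟫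
        + B y v + η * B δy v + B δyp v = 0) :
    0 = (1 / (2 * τ ^ 2)) * (‖δyp‖ ^ 2 - ‖δy‖ ^ 2)
        + E (y + δyp) - E y
        + ((1 - η) / (2 * τ ^ 2)) * (‖δy‖ ^ 2 + ‖δyp‖ ^ 2)
        + ((1 + η) / 2) * B δyp δyp + (η / 2) * B δy δy
        + (η / (2 * τ ^ 2)) * ‖δyp - δy‖ ^ 2
        - (η / 2) * B (δyp - δy) (δyp - δy) := by
  have h := hrel δyp
  rw [inner_sub_left, real_inner_self_eq_norm_sq] at h
  rw [hE, hE, norm_sub_sq_real, real_inner_comm]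
  simp only [map_add, map_sub, LinearMap.add_apply, LinearMap.sub_apply]
  rw [hBsymm δyp y, hBsymm δyp δy]
  have hτ' : τ ≠ 0 := hτ.ne'
  rw [← h]
  field_simp
  ring
end

section
/- Suppose the triple (y, δy, δy⁺) satisfies the one-step accelerated-flow relation with time step τ > 0 and damping parameter η satisfying 0 ≤ η < 1. Assume B is positive semidefinite (B(v,v) ≥ 0 for all v ∈ H) and bounded relative to the step size in the sense that B(v,v) ≤ (1/τ²)·‖v‖² for all v ∈ H. Then the total-energy stability estimate holds: E(y⁺) + (1/(2τ²))·‖δy⁺‖² + ((1−η)/(2τ²))·‖δy⁺‖² ≤ E(y) + (1/(2τ²))·‖δy‖². -/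
open RealInnerProductSpace

/-- Total energy stability for one step of the accelerated gradient flow
(abstract form of Theorem 2.1). -/
theorem accelerated_flow_total_energy_stability
    {H : Type*} [NormedAddCommGroup H] [InnerProductSpace ℝ H]
    (B : H →ₗ[ℝ] H →ₗ[ℝ] ℝ)
    (hBsymm : ∀ u v : H, B u v = B v u)
    (E : H → ℝ) (hE : ∀ z : H, E z = (1 / 2) * B z z)
    (τ : ℝ) (hτ : 0 < τ) (η : ℝ) (hη0 : 0 ≤ η) (hη1 : η < 1)
    (hBpos : ∀ v : H, 0 ≤ B v v)
    (hBbound : ∀ v : H, B v v ≤ (1 / τ ^ 2) * ‖v‖ ^ 2)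
    (y δy δyp : H)
    (hrel : ∀ v : H,
      (1 / τ ^ 2) * ⟪δyp - δy, v⟫ + ((1 - η) / τ ^ 2) * ⟪δy, v⟫
        + B y v + η * B δy v + B δyp v = 0) :
    E (y + δyp) + (1 / (2 * τ ^ 2)) * ‖δyp‖ ^ 2
        + ((1 - η) / (2 * τ ^ 2)) * ‖δyp‖ ^ 2
      ≤ E y + (1 / (2 * τ ^ 2)) * ‖δy‖ ^ 2 := by
  have hflow := hrel δyp
  have hbound := hBbound (δy - δyp)
  have hnorm := norm_sub_sq_real δy δyp
  have hτ2 : (0 : ℝ) < 1 / τ ^ 2 := by positivity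
  have hcoef : 1 / (2 * τ ^ 2) = 1 / τ ^ 2 / 2 := by field_simp
  have hcoef_damped : (1 - η) / (2 * τ ^ 2) = (1 - η) * (1 / τ ^ 2) / 2 := by field_simp
  have hcoef_flow : (1 - η) / τ ^ 2 = (1 - η) * (1 / τ ^ 2) := by ring
  rw [inner_sub_left, real_inner_self_eq_norm_sq, hcoef_flow] at hflow
  rw [hnorm] at hbound
  simp only [map_sub, LinearMap.sub_apply, hBsymm δyp δy] at hbound
  rw [hE, hE, hcoef, hcoef_damped]
  simp only [map_add, LinearMap.add_apply, hBsymm δyp y]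
  have hquad := mul_le_mul_of_nonneg_left hbound hη0
  have hd := mul_nonneg hη0 (hBpos δy)
  have hp := mul_nonneg hη0 (hBpos δyp)
  have hkin : 0 ≤ (1 - η) * (1 / τ ^ 2 * ‖δy‖ ^ 2) :=
    mul_nonneg (sub_nonneg.2 hη1.le) (by positivity)
  linarith [hBpos δyp]
end

section
/- Let τ > 0, let B be a symmetric positive semidefinite bilinear form on H (B(v,v) ≥ 0 for all v), and let y₀, δy ∈ H satisfy the implicit gradient-flow relation: for every v ∈ H, (1/τ²)·⟨δy, v⟩ + B(δy, v) + B(y₀, v) = 0. Then E(y₀ + δy) + (1/τ²)·‖δy‖² ≤ E(y₀). -/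
open RealInnerProductSpace

/-- Energy stability of one implicit gradient-flow step (abstract form of (2.12)). -/
theorem implicit_gradient_flow_energy_stability
    {H : Type*} [NormedAddCommGroup H] [InnerProductSpace ℝ H]
    (B : H →ₗ[ℝ] H →ₗ[ℝ] ℝ)
    (hBsymm : ∀ u v : H, B u v = B v u)
    (E : H → ℝ) (hE : ∀ z : H, E z = (1 / 2) * B z z)
    (τ : ℝ) (hτ : 0 < τ)
    (hBpos : ∀ v : H, 0 ≤ B v v)
    (y₀ δy : H)
    (hrel : ∀ v : H,
      (1 / τ ^ 2) * ⟪δy, v⟫ + B δy v + B y₀ v = 0) :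
    E (y₀ + δy) + (1 / τ ^ 2) * ‖δy‖ ^ 2 ≤ E y₀ := by
  have h := hrel δy
  rw [real_inner_self_eq_norm_sq] at h
  have hsymm := hBsymm δy y₀
  have hpos := hBpos δy
  simp only [hE, map_add, LinearMap.add_apply]
  linarith
end

section
/- Suppose (yₙ)_{n≥0} is generated by the accelerated-flow iteration with time step τ > 0 and Nesterov damping parameters ηₙ = (n−1)/(n+α−1) for some real α ≥ 3. Assume B is coercive with constant C > 0 (B(v,v) ≥ C·‖v‖² for all v ∈ H) and satisfies B(v,v) ≤ (1/τ²)·‖v‖² for all v ∈ H. Then the increments tend to zero: limₙ→∞ ‖δyₙ‖ = 0. -/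
open RealInnerProductSpace

/-- One step of the accelerated flow dissipates the total energy
`B x x + (a ‖d‖ ^ 2 - B d d)` (twice the potential plus kinetic energy). -/
theorem accelerated_flow_energy_step
    {H : Type*} [NormedAddCommGroup H] [InnerProductSpace ℝ H]
    (B : H →ₗ[ℝ] H →ₗ[ℝ] ℝ) (hBsymm : ∀ u v : H, B u v = B v u)
    {a η : ℝ} (hη₀ : 0 ≤ η) (hη₁ : η ≤ 1) (hBbound : ∀ v : H, B v v ≤ a * ‖v‖ ^ 2)
    {x d e : H}
    (hrel : a * ⟪e - d, e⟫ + (1 - η) * a * ⟪d, e⟫ + B x e + η * B d e + B e e = 0) :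
    B (x + e) (x + e) + (a * ‖e‖ ^ 2 - B e e) + 3 * B e e
      ≤ B x x + (a * ‖d‖ ^ 2 - B d d) := by
  have hcross := hBbound (d - e)
  have hd := hBbound d
  have he := hBbound e
  rw [norm_sub_sq_real] at hcross
  simp only [map_sub, map_add, LinearMap.sub_apply, LinearMap.add_apply, inner_sub_left,
    real_inner_self_eq_norm_sq] at *
  rw [hBsymm e d] at hcross
  rw [hBsymm e x]
  nlinarith [mul_le_mul_of_nonneg_left hcross hη₀,
    mul_nonneg (sub_nonneg.2 hη₁) (sub_nonneg.2 hd),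
    mul_nonneg (sub_nonneg.2 hη₁) (sub_nonneg.2 he)]

/-- If a nonnegative sequence drops by at least `u n` at each step, then `u` tends to zero. -/
theorem tendsto_zero_of_add_le_of_nonneg {F u : ℕ → ℝ} (hF : ∀ n, 0 ≤ F n) (hu : ∀ n, 0 ≤ u n)
    (h : ∀ n, F (n + 1) + u n ≤ F n) : Filter.Tendsto u Filter.atTop (nhds 0) := by
  have hanti : Antitone F := antitone_nat_of_succ_le fun n => by linarith [h n, hu n]
  have hlim := tendsto_atTop_ciInf hanti ⟨0, by rintro _ ⟨n, rfl⟩; exact hF n⟩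
  have hdiff := hlim.sub ((Filter.tendsto_add_atTop_iff_nat 1).2 hlim)
  rw [sub_self] at hdiff
  exact squeeze_zero hu (fun n => by linarith [h n]) hdiff

/-- Vanishing of the increments for the accelerated flow with Nesterov damping
(abstract form of Corollary 2.2). -/
theorem accelerated_flow_increments_tendsto_zero
    {H : Type*} [NormedAddCommGroup H] [InnerProductSpace ℝ H]
    (B : H →ₗ[ℝ] H →ₗ[ℝ] ℝ)
    (hBsymm : ∀ u v : H, B u v = B v u)
    (τ : ℝ) (hτ : 0 < τ)
    (α : ℝ) (hα : 3 ≤ α)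
    (C : ℝ) (hC : 0 < C)
    (hBcoer : ∀ v : H, C * ‖v‖ ^ 2 ≤ B v v)
    (hBbound : ∀ v : H, B v v ≤ (1 / τ ^ 2) * ‖v‖ ^ 2)
    (y : ℕ → H)
    (hfirst : ∀ v : H,
      (1 / τ ^ 2) * ⟪y 1 - y 0, v⟫ + B (y 1 - y 0) v + B (y 0) v = 0)
    (hrel : ∀ n : ℕ, 1 ≤ n → ∀ v : H,
      (1 / τ ^ 2) * ⟪(y (n + 1) - y n) - (y n - y (n - 1)), v⟫
        + ((1 - ((n : ℝ) - 1) / ((n : ℝ) + α - 1)) / τ ^ 2) * ⟪y n - y (n - 1), v⟫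
        + B (y n) v + (((n : ℝ) - 1) / ((n : ℝ) + α - 1)) * B (y n - y (n - 1)) v
        + B (y (n + 1) - y n) v = 0) :
    Filter.Tendsto (fun n : ℕ => ‖y n - y (n - 1)‖) Filter.atTop (nhds 0) := by
  have hBnonneg (v : H) : 0 ≤ B v v := le_trans (by positivity) (hBcoer v)
  have hstep (n : ℕ) :
      B (y (n + 2)) (y (n + 2)) + (1 / τ ^ 2 * ‖y (n + 2) - y (n + 1)‖ ^ 2
          - B (y (n + 2) - y (n + 1)) (y (n + 2) - y (n + 1)))
        + 3 * B (y (n + 2) - y (n + 1)) (y (n + 2) - y (n + 1))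
      ≤ B (y (n + 1)) (y (n + 1)) + (1 / τ ^ 2 * ‖y (n + 1) - y n‖ ^ 2
          - B (y (n + 1) - y n) (y (n + 1) - y n)) := by
    have hpos : 0 < ((n + 1 : ℕ) : ℝ) + α - 1 := by
      push_cast; linarith [n.cast_nonneg (α := ℝ)]
    have hη₀ : 0 ≤ (((n + 1 : ℕ) : ℝ) - 1) / (((n + 1 : ℕ) : ℝ) + α - 1) :=
      div_nonneg (by push_cast; linarith [n.cast_nonneg (α := ℝ)]) hpos.le
    have hη₁ : (((n + 1 : ℕ) : ℝ) - 1) / (((n + 1 : ℕ) : ℝ) + α - 1) ≤ 1 :=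
      (div_le_one hpos).2 (by linarith)
    have hrel' := hrel (n + 1) n.succ_pos (y (n + 2) - y (n + 1))
    rw [div_eq_mul_one_div (1 - _)] at hrel'
    have henergy := accelerated_flow_energy_step B hBsymm hη₀ hη₁ hBbound hrel'
    rw [add_sub_cancel] at henergy
    exact henergy
  have hlim := tendsto_zero_of_add_le_of_nonneg
    (F := fun n => B (y (n + 1)) (y (n + 1)) + (1 / τ ^ 2 * ‖y (n + 1) - y n‖ ^ 2
      - B (y (n + 1) - y n) (y (n + 1) - y n)))
    (fun n => add_nonneg (hBnonneg _) (sub_nonneg.2 (hBbound _)))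
    (fun n => mul_nonneg zero_le_three (hBnonneg _)) hstep
  have hsq : Filter.Tendsto (fun n => ‖y (n + 2) - y (n + 1)‖ ^ 2) Filter.atTop (nhds 0) := by
    have hdiv := hlim.div_const (3 * C)
    rw [zero_div] at hdiv
    refine squeeze_zero (fun n => sq_nonneg _) (fun n => ?_) hdiv
    rw [le_div_iff₀ (by positivity)]
    linarith [hBcoer (y (n + 2) - y (n + 1))]
  rw [← Filter.tendsto_add_atTop_iff_nat 2]
  simpa [Real.sqrt_sq] using hsq.sqrt
end

section
/- Suppose M ≥ 0 and ε ≥ 0 are such that |Z(x)ᵢⱼ| ≤ M for every x ∈ Ω and i, j ∈ {1,2}, and that the isometry defect satisfies ∫_Ω ‖Dy(x)ᵀDy(x) − I₂‖_F² dx ≤ ε², where I₂ is the 2×2 identity matrix. Then the Hessian seminorm is controlled by the bilayer energy: ∫_Ω |D²y|² ≤ 4·E_bi[y] + 64·M²·(ε² + 2|Ω|). -/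
open Matrix MeasureTheory

/-- The partial derivative `∂ᵢ y` of a map `y : ℝ² → ℝ³`. -/
noncomputable def pderiv1 (y : (Fin 2 → ℝ) → (Fin 3 → ℝ)) (i : Fin 2)
    (x : Fin 2 → ℝ) : Fin 3 → ℝ :=
  fderiv ℝ y x (Pi.single i 1)

/-- The second partial derivative `∂ᵢⱼ y` of a map `y : ℝ² → ℝ³`. -/
noncomputable def pderiv2 (y : (Fin 2 → ℝ) → (Fin 3 → ℝ)) (i j : Fin 2)
    (x : Fin 2 → ℝ) : Fin 3 → ℝ :=
  fderiv ℝ (fun z => fderiv ℝ y z (Pi.single i 1)) x (Pi.single j 1)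

/-- `|D²y(x)|² = Σ_{i,j} ‖∂ᵢⱼ y(x)‖²` (squared Euclidean norms). -/
noncomputable def hessSq (y : (Fin 2 → ℝ) → (Fin 3 → ℝ)) (x : Fin 2 → ℝ) : ℝ :=
  ∑ i : Fin 2, ∑ j : Fin 2, ∑ k : Fin 3, (pderiv2 y i j x k) ^ 2

/-- The Jacobian matrix (in `ℝ^{3×2}`) of a map `y : ℝ² → ℝ³` at a point `x`. -/
noncomputable def jacobian (y : (Fin 2 → ℝ) → (Fin 3 → ℝ)) (x : Fin 2 → ℝ) :
    Matrix (Fin 3) (Fin 2) ℝ :=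
  fun k i => fderiv ℝ y x (Pi.single i 1) k

/-- The Frobenius norm of a matrix `A`. -/
noncomputable def frobeniusNorm {m n : Type*} [Fintype m] [Fintype n]
    (A : Matrix m n ℝ) : ℝ :=
  Real.sqrt (∑ i, ∑ j, (A i j) ^ 2)

/-- The bilayer bending energy
`E_bi[y] = (1/2)∫_Ω |D²y|² − Σ_{i,j} ∫_Ω (∂ᵢⱼy · (∂₁y × ∂₂y)) Zᵢⱼ`. -/
noncomputable def bilayerEnergy (Ω : Set (Fin 2 → ℝ))
    (Z : (Fin 2 → ℝ) → Matrix (Fin 2) (Fin 2) ℝ)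
    (y : (Fin 2 → ℝ) → (Fin 3 → ℝ)) : ℝ :=
  (1 / 2) * (∫ x in Ω, hessSq y x)
    - ∑ i : Fin 2, ∑ j : Fin 2,
        ∫ x in Ω,
          (pderiv2 y i j x ⬝ᵥ (crossProduct (pderiv1 y 0 x) (pderiv1 y 1 x)))
            * Z x i j

/-- Lagrange's identity combined with `det (AᵀA) ≤ ‖AᵀA - 1‖² + 2` for a `3 × 2` matrix `A`
with columns `a` and `b`. -/
theorem sum_sq_crossProduct_le (A : Matrix (Fin 3) (Fin 2) ℝ) :
    ∑ k : Fin 3, (crossProduct (fun l => A l 0) (fun l => A l 1) k) ^ 2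
      ≤ (frobeniusNorm (Aᵀ * A - 1)) ^ 2 + 2 := by
  rw [frobeniusNorm, Real.sq_sqrt (by positivity)]
  simp only [cross_apply, Fin.sum_univ_two, Fin.sum_univ_three, Matrix.sub_apply,
    Matrix.mul_apply, Matrix.transpose_apply, Matrix.one_apply, Matrix.cons_val_zero,
    Matrix.cons_val_one, Matrix.cons_val, Fin.isValue, if_true,
    zero_ne_one, one_ne_zero, if_false]
  generalize A 0 0 = a
  generalize A 1 0 = b
  generalize A 2 0 = c
  generalize A 0 1 = u
  generalize A 1 1 = v
  generalize A 2 1 = w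
  have key : ∀ p q r : ℝ, (1 + p) * (1 + r) - q ^ 2 ≤
      p ^ 2 + q ^ 2 + (q ^ 2 + r ^ 2) + 2 := fun p q r => by
    nlinarith [sq_nonneg (p - r), sq_nonneg (p - 1), sq_nonneg (r - 1), sq_nonneg q]
  have h := key (a * a + b * b + c * c - 1) (a * u + b * v + c * w) (u * u + v * v + w * w - 1)
  linarith

/-- Weighted Young inequality for a dot product with a weight bounded by `M`. -/
theorem four_mul_dotProduct_mul_le (h n : Fin 3 → ℝ) {z M : ℝ} (hz : |z| ≤ M) :
    4 * ((h ⬝ᵥ n) * z) ≤ ∑ k, h k ^ 2 + 4 * M ^ 2 * ∑ k, n k ^ 2 := by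
  have hzM : z ^ 2 ≤ M ^ 2 := sq_le_sq' (by linarith [abs_le.mp hz]) (abs_le.mp hz).2
  calc 4 * ((h ⬝ᵥ n) * z) ≤ ∑ k, h k ^ 2 + 4 * z ^ 2 * ∑ k, n k ^ 2 := by
        simp only [dotProduct, Fin.sum_univ_three]
        nlinarith [sq_nonneg (h 0 - 2 * z * n 0), sq_nonneg (h 1 - 2 * z * n 1),
          sq_nonneg (h 2 - 2 * z * n 2)]
    _ ≤ ∑ k, h k ^ 2 + 4 * M ^ 2 * ∑ k, n k ^ 2 := by gcongr

/-- The pointwise estimate behind the coercivity of the bilayer energy. -/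
theorem four_mul_bilayer_integrand_le (y : (Fin 2 → ℝ) → (Fin 3 → ℝ)) (x : Fin 2 → ℝ)
    (z : Matrix (Fin 2) (Fin 2) ℝ) {M : ℝ} (hz : ∀ i j, |z i j| ≤ M) :
    4 * ∑ i : Fin 2, ∑ j : Fin 2,
        (pderiv2 y i j x ⬝ᵥ (crossProduct (pderiv1 y 0 x) (pderiv1 y 1 x))) * z i j
      ≤ hessSq y x
        + 16 * M ^ 2 * ((frobeniusNorm ((jacobian y x)ᵀ * jacobian y x - 1)) ^ 2 + 2) := by
  have hn : ∑ k : Fin 3, (crossProduct (pderiv1 y 0 x) (pderiv1 y 1 x) k) ^ 2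
      ≤ (frobeniusNorm ((jacobian y x)ᵀ * jacobian y x - 1)) ^ 2 + 2 :=
    sum_sq_crossProduct_le (jacobian y x)
  have hT := fun i j => four_mul_dotProduct_mul_le (pderiv2 y i j x)
    (crossProduct (pderiv1 y 0 x) (pderiv1 y 1 x)) (hz i j)
  have hM := mul_le_mul_of_nonneg_left hn (by positivity : 0 ≤ 16 * M ^ 2)
  rw [hessSq]
  simp only [Fin.sum_univ_two (M := ℝ)]
  linarith [hT 0 0, hT 0 1, hT 1 0, hT 1 1]

/-- Quantitative (seminorm) form of Lemma 3.2 (coercivity for bilayer plates):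
the Hessian seminorm is controlled by the bilayer energy and the isometry defect. -/
theorem bilayer_coercivity_seminorm
    (Ω : Set (Fin 2 → ℝ)) (hΩ : MeasurableSet Ω) (hΩfin : volume Ω < ⊤)
    (y : (Fin 2 → ℝ) → (Fin 3 → ℝ)) (hy : ContDiff ℝ 2 y)
    (Z : (Fin 2 → ℝ) → Matrix (Fin 2) (Fin 2) ℝ)
    (M ε : ℝ) (hM : 0 ≤ M) (hε : 0 ≤ ε)
    (hZ : ∀ x ∈ Ω, ∀ i j : Fin 2, |Z x i j| ≤ M)
    (hdefect : ∫ x in Ω, (frobeniusNorm ((jacobian y x)ᵀ * jacobian y x - 1)) ^ 2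
      ≤ ε ^ 2)
    (hint1 : IntegrableOn (fun x => hessSq y x) Ω volume)
    (hint2 : ∀ i j : Fin 2, IntegrableOn
      (fun x => (pderiv2 y i j x ⬝ᵥ (crossProduct (pderiv1 y 0 x) (pderiv1 y 1 x)))
        * Z x i j) Ω volume)
    (hint3 : IntegrableOn (fun x => (frobeniusNorm (jacobian y x)) ^ 4) Ω volume)
    (hint4 : IntegrableOn
      (fun x => (frobeniusNorm ((jacobian y x)ᵀ * jacobian y x - 1)) ^ 2) Ω volume) :
    ∫ x in Ω, hessSq y x
      ≤ 4 * bilayerEnergy Ω Z y + 64 * M ^ 2 * (ε ^ 2 + 2 * (volume Ω).toReal) := by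
  have hsum : IntegrableOn (fun x => ∑ i : Fin 2, ∑ j : Fin 2,
      (pderiv2 y i j x ⬝ᵥ (crossProduct (pderiv1 y 0 x) (pderiv1 y 1 x))) * Z x i j) Ω volume :=
    integrable_finsetSum _ fun i _ => integrable_finsetSum _ fun j _ => hint2 i j
  have hconst : IntegrableOn (fun _ : Fin 2 → ℝ => (2 : ℝ)) Ω volume :=
    integrableOn_const hΩfin.ne
  have hdef2 : IntegrableOn (fun x => 16 * M ^ 2 *
      ((frobeniusNorm ((jacobian y x)ᵀ * jacobian y x - 1)) ^ 2 + 2)) Ω volume :=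
    (hint4.add hconst).const_mul (16 * M ^ 2)
  have hmono := setIntegral_mono_on (hsum.const_mul 4) (hint1.add hdef2) hΩ
    fun x hx => four_mul_bilayer_integrand_le y x (Z x) (hZ x hx)
  have hright : ∫ x in Ω, (hessSq y x + 16 * M ^ 2 *
        ((frobeniusNorm ((jacobian y x)ᵀ * jacobian y x - 1)) ^ 2 + 2))
      = (∫ x in Ω, hessSq y x) + 16 * M ^ 2 *
        ((∫ x in Ω, (frobeniusNorm ((jacobian y x)ᵀ * jacobian y x - 1)) ^ 2)
          + 2 * (volume Ω).toReal) := by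
    rw [integral_add hint1 hdef2, integral_const_mul, integral_add hint4 hconst,
      setIntegral_const, smul_eq_mul, measureReal_def, mul_comm (volume Ω).toReal]
  have hleft : ∫ x in Ω, ∑ i : Fin 2, ∑ j : Fin 2,
        (pderiv2 y i j x ⬝ᵥ (crossProduct (pderiv1 y 0 x) (pderiv1 y 1 x))) * Z x i j
      = ∑ i : Fin 2, ∑ j : Fin 2, ∫ x in Ω,
        (pderiv2 y i j x ⬝ᵥ (crossProduct (pderiv1 y 0 x) (pderiv1 y 1 x))) * Z x i j := by
    rw [integral_finsetSum _ fun i _ => integrable_finsetSum _ fun j _ => hint2 i j]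
    exact Finset.sum_congr rfl fun i _ => integral_finsetSum _ fun j _ => hint2 i j
  have hmain := hmono.trans_eq hright
  rw [integral_const_mul, hleft] at hmain
  have hbound : 16 * M ^ 2 *
        ((∫ x in Ω, (frobeniusNorm ((jacobian y x)ᵀ * jacobian y x - 1)) ^ 2)
          + 2 * (volume Ω).toReal)
      ≤ 64 * M ^ 2 * (ε ^ 2 + 2 * (volume Ω).toReal) := by
    gcongr
    norm_num
  rw [bilayerEnergy]
  linarith
end

section
/- Suppose the triple (y, δy, δy⁺) satisfies the bilayer one-step relation with time step τ > 0, damping parameter η ∈ ℝ, and linear functionals L, R. Then the following identity holds: (1/(2τ²))·(‖δy⁺‖² − ‖δy‖²) + (1/2)·B(y⁺, y⁺) − (1/2)·B(y, y) + ((1−η)/(2τ²))·(‖δy‖² + ‖δy⁺‖²) + ((1+η)/2)·B(δy⁺, δy⁺) + (η/2)·B(δy, δy) + (η/(2τ²))·‖δy⁺ − δy‖² − (η/2)·B(δy⁺ − δy, δy⁺ − δy) = L(δy⁺) + R(δy⁺). -/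
open RealInnerProductSpace

/-- Energy identity for one step of the implicit–explicit accelerated gradient
flow for bilayer plates (abstract form of (A.1)). -/
theorem bilayer_one_step_energy_identity
    {H : Type*} [NormedAddCommGroup H] [InnerProductSpace ℝ H]
    (B : H →ₗ[ℝ] H →ₗ[ℝ] ℝ)
    (hBsymm : ∀ u v : H, B u v = B v u)
    (L R : H →ₗ[ℝ] ℝ)
    (τ : ℝ) (hτ : 0 < τ) (η : ℝ)
    (y δy δyp : H)
    (hrel : ∀ v : H,
      (1 / τ ^ 2) * ⟪δyp - δy, v⟫ + ((1 - η) / τ ^ 2) * ⟪δy, v⟫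
        + B y v - L v + η * B δy v + B δyp v = R v) :
    (1 / (2 * τ ^ 2)) * (‖δyp‖ ^ 2 - ‖δy‖ ^ 2)
      + (1 / 2) * B (y + δyp) (y + δyp) - (1 / 2) * B y y
      + ((1 - η) / (2 * τ ^ 2)) * (‖δy‖ ^ 2 + ‖δyp‖ ^ 2)
      + ((1 + η) / 2) * B δyp δyp + (η / 2) * B δy δy
      + (η / (2 * τ ^ 2)) * ‖δyp - δy‖ ^ 2
      - (η / 2) * B (δyp - δy) (δyp - δy)
      = L δyp + R δyp := by
  have h := hrel δyp
  rw [inner_sub_left, real_inner_self_eq_norm_sq, real_inner_comm] at h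
  rw [norm_sub_sq_real]
  simp only [map_add, map_sub, LinearMap.add_apply, LinearMap.sub_apply]
  rw [hBsymm δyp y, hBsymm δyp δy]
  linear_combination h
end

section
/- Suppose the triple (y, δy, δy⁺) satisfies the bilayer one-step relation with time step τ > 0, damping parameter η satisfying 0 ≤ η < 1, and linear functionals L, R. Assume B is positive semidefinite (B(v,v) ≥ 0 for all v ∈ H), satisfies B(v,v) ≤ (1/τ²)·‖v‖² for all v ∈ H, and that the explicit and remainder terms obey the smallness bound L(δy⁺) + R(δy⁺) ≤ ((1−η)/(4τ²))·(‖δy⁺‖² + ‖δy‖²). Then the stability estimate holds: (1/2)·B(y⁺, y⁺) + (1/(2τ²))·‖δy⁺‖² + ((1−η)/(4τ²))·(‖δy⁺‖² + ‖δy‖²) ≤ (1/2)·B(y, y) + (1/(2τ²))·‖δy‖². -/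
open RealInnerProductSpace

/-- One-step stability estimate for the implicit–explicit accelerated gradient
flow for bilayer plates (abstract form of Step (ii) in the proof of Theorem 3.3). -/
theorem bilayer_one_step_stability
    {H : Type*} [NormedAddCommGroup H] [InnerProductSpace ℝ H]
    (B : H →ₗ[ℝ] H →ₗ[ℝ] ℝ)
    (hBsymm : ∀ u v : H, B u v = B v u)
    (L R : H →ₗ[ℝ] ℝ)
    (τ : ℝ) (hτ : 0 < τ) (η : ℝ) (hη0 : 0 ≤ η) (hη1 : η < 1)
    (hBpos : ∀ v : H, 0 ≤ B v v)
    (hBbound : ∀ v : H, B v v ≤ (1 / τ ^ 2) * ‖v‖ ^ 2)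
    (y δy δyp : H)
    (hrel : ∀ v : H,
      (1 / τ ^ 2) * ⟪δyp - δy, v⟫ + ((1 - η) / τ ^ 2) * ⟪δy, v⟫
        + B y v - L v + η * B δy v + B δyp v = R v)
    (hsmall : L δyp + R δyp
        ≤ ((1 - η) / (4 * τ ^ 2)) * (‖δyp‖ ^ 2 + ‖δy‖ ^ 2)) :
    (1 / 2) * B (y + δyp) (y + δyp) + (1 / (2 * τ ^ 2)) * ‖δyp‖ ^ 2
        + ((1 - η) / (4 * τ ^ 2)) * (‖δyp‖ ^ 2 + ‖δy‖ ^ 2)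
      ≤ (1 / 2) * B y y + (1 / (2 * τ ^ 2)) * ‖δy‖ ^ 2 := by
  have htest := hrel δyp
  have hdiff := mul_le_mul_of_nonneg_left (hBbound (δyp - δy)) hη0
  have hp := hBpos δyp
  have hηp := mul_nonneg hη0 hp
  have hηd := mul_nonneg hη0 (hBpos δy)
  have h_quarter : (1 - η) / (4 * τ ^ 2) = (1 - η) * (1 / τ ^ 2) / 4 := by field_simp
  have h_half : 1 / (2 * τ ^ 2) = 1 / τ ^ 2 / 2 := by field_simp
  have h_damp : (1 - η) / τ ^ 2 = (1 - η) * (1 / τ ^ 2) := by field_simp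
  rw [h_quarter] at hsmall ⊢
  rw [h_half]
  rw [h_damp, inner_sub_left, real_inner_self_eq_norm_sq, real_inner_comm] at htest
  rw [norm_sub_sq_real] at hdiff
  simp only [map_add, map_sub, LinearMap.add_apply, LinearMap.sub_apply] at hdiff ⊢
  rw [hBsymm δyp δy] at hdiff
  rw [hBsymm δyp y]
  linarith
end
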